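/- arXiv:1908.03389 — 3 statements merged into one kernel-verified Lean document; each statement's English description precedes it below -/
import Mathlib

section
/- Let G = (V,E) be a finite simple graph, let G' be the full subdivision of G, and let k be an integer with k > 2. Then there exists a partition (S₁, S₂) of V with S₁ and S₂ nonempty, G[S₁] and G[S₂] both connected, and at least k edges of G having exactly one endpoint in S₁, if and only if there exists a partition (S₁', S₂') of the vertex set of G' with S₁' and S₂' nonempty, G'[S₁'] and G'[S₂'] both connected, and at least k edges of G' having exactly one endpoint in S₁'. -/
/-- The set of edges of `G` having exactly one endpoint in `S` (the cutset `δ(S)`). -/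
def cutEdges {V : Type*} (G : SimpleGraph V) (S : Set V) : Set (Sym2 V) :=
  {e | e ∈ G.edgeSet ∧ ∃ u ∈ S, ∃ v, v ∉ S ∧ e = s(u, v)}

/-- The full subdivision of `G`: one new vertex `v_e` per edge `e`, adjacent exactly to the
two endpoints of `e`. -/
def fullSubdivision {V : Type*} (G : SimpleGraph V) : SimpleGraph (V ⊕ G.edgeSet) :=
  SimpleGraph.fromRel (fun a b =>
    ∃ (u : V) (e : G.edgeSet), a = Sum.inl u ∧ b = Sum.inr e ∧ u ∈ (e : Sym2 V))

open SimpleGraph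

theorem cutEdges_compl {V : Type*} (G : SimpleGraph V) (S : Set V) :
    cutEdges G Sᶜ = cutEdges G S := by
  ext e
  simp only [cutEdges, Set.mem_ofPred_eq, Set.mem_compl_iff, not_not]
  constructor <;> rintro ⟨he, u, hu, v, hv, rfl⟩ <;> exact ⟨he, v, hv, u, hu, Sym2.eq_swap⟩

theorem mk_mem_cutEdges {V : Type*} {G : SimpleGraph V} {S : Set V} {u v : V} :
    s(u, v) ∈ cutEdges G S ↔ G.Adj u v ∧ ¬(u ∈ S ↔ v ∈ S) := by
  simp only [cutEdges, Set.mem_ofPred_eq, mem_edgeSet, Sym2.eq_iff]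
  grind

theorem fullSubdivision_adj_inl_inr {V : Type*} {G : SimpleGraph V} {u : V} {e : G.edgeSet} :
    (fullSubdivision G).Adj (Sum.inl u) (Sum.inr e) ↔ u ∈ (e : Sym2 V) := by
  simp [fullSubdivision]

theorem fullSubdivision_adj {V : Type*} {G : SimpleGraph V} {a b : V ⊕ G.edgeSet} :
    (fullSubdivision G).Adj a b ↔ ∃ (u : V) (e : G.edgeSet), u ∈ (e : Sym2 V) ∧
      (a = Sum.inl u ∧ b = Sum.inr e ∨ a = Sum.inr e ∧ b = Sum.inl u) := by
  rcases a with a | a <;> rcases b with b | b <;> simp [fullSubdivision]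

theorem mem_cutEdges_fullSubdivision {V : Type*} {G : SimpleGraph V}
    {S : Set (V ⊕ G.edgeSet)} {x : Sym2 (V ⊕ G.edgeSet)} :
    x ∈ cutEdges (fullSubdivision G) S ↔ ∃ (u : V) (e : G.edgeSet), u ∈ (e : Sym2 V) ∧
      ¬(Sum.inl u ∈ S ↔ Sum.inr e ∈ S) ∧ x = s(Sum.inl u, Sum.inr e) := by
  constructor
  · induction x with | _ a b
    rw [mk_mem_cutEdges, fullSubdivision_adj]
    rintro ⟨⟨u, e, hu, ⟨rfl, rfl⟩ | ⟨rfl, rfl⟩⟩, h⟩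
    · exact ⟨u, e, hu, h, rfl⟩
    · exact ⟨u, e, hu, fun h' => h h'.symm, Sym2.eq_swap⟩
  · rintro ⟨u, e, hu, h, rfl⟩
    exact mk_mem_cutEdges.2 ⟨fullSubdivision_adj_inl_inr.2 hu, h⟩

/-- Every subdivision vertex lies on the same side of the cut `(S, Sᶜ)` as at least one of its two
neighbours. -/
def IsAttached {V : Type*} {G : SimpleGraph V} (S : Set (V ⊕ G.edgeSet)) : Prop :=
  ∀ e : G.edgeSet, ∃ u ∈ (e : Sym2 V), (Sum.inl u ∈ S ↔ Sum.inr e ∈ S)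

theorem IsAttached.compl {V : Type*} {G : SimpleGraph V} {S : Set (V ⊕ G.edgeSet)}
    (h : IsAttached S) : IsAttached Sᶜ := fun e =>
  let ⟨u, hu, hs⟩ := h e
  ⟨u, hu, not_congr hs⟩

theorem IsAttached.ncard_cutEdges {V : Type*} {G : SimpleGraph V} {S : Set (V ⊕ G.edgeSet)}
    (h : IsAttached S) :
    (cutEdges (fullSubdivision G) S).ncard = (cutEdges G (Sum.inl ⁻¹' S)).ncard := by
  choose u e hu hs hx using fun x (hx : x ∈ cutEdges (fullSubdivision G) S) =>
    mem_cutEdges_fullSubdivision.1 hx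
  refine Set.ncard_congr (fun x hx => (e x hx : Sym2 V)) ?_ ?_ ?_
  · intro x hxS
    have hu := hu x hxS
    have hs := hs x hxS
    obtain ⟨w, hw, hws⟩ := h (e x hxS)
    have hne : u x hxS ≠ w := fun h => hs (h ▸ hws)
    have he := (Sym2.mem_and_mem_iff hne).1 ⟨hu, hw⟩
    have hadj := (e x hxS).2
    rw [he] at hadj ⊢
    exact mk_mem_cutEdges.2 ⟨hadj, fun h => hs (h.trans hws)⟩
  · intro x y hxS hyS hxy
    have hxy : e x hxS = e y hyS := Subtype.ext hxy
    rw [hx x hxS, hx y hyS]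
    obtain ⟨w, hw, hws⟩ := h (e x hxS)
    have hux := hu x hxS
    have huy := hu y hyS
    have hsx := hs x hxS
    have hsy := hs y hyS
    rw [← hxy] at huy hsy ⊢
    have hne : u x hxS ≠ w := fun h => hsx (h ▸ hws)
    have hne' : u y hyS ≠ w := fun h => hsy (h ▸ hws)
    rw [(Sym2.mem_and_mem_iff hne).1 ⟨hux, hw⟩, Sym2.mem_iff] at huy
    rw [huy.resolve_right hne']
  · intro f hf
    have hfE := hf.1
    obtain ⟨w, hw, hws⟩ := h ⟨f, hfE⟩
    obtain ⟨v, rfl⟩ := Sym2.mem_iff_exists.1 hw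
    have hv := (mk_mem_cutEdges.1 hf).2
    have hmem : s(Sum.inl v, Sum.inr ⟨s(w, v), hfE⟩) ∈ cutEdges (fullSubdivision G) S :=
      mem_cutEdges_fullSubdivision.2
        ⟨v, _, Sym2.mem_mk_right w v, fun h => hv (hws.trans h.symm), rfl⟩
    refine ⟨_, hmem, ?_⟩
    have := hx _ hmem
    simp only [Sym2.eq_iff, Sum.inr.injEq, reduceCtorEq, false_and, or_false] at this
    exact congrArg Subtype.val this.2.symm

theorem SimpleGraph.Connected.of_adj_reachable {V W : Type*} {G : SimpleGraph V}
    {H : SimpleGraph W} (hG : G.Connected) (f : V → W)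
    (hf : ∀ a b, G.Adj a b → H.Reachable (f a) (f b))
    (hsurj : ∀ y, ∃ x, H.Reachable (f x) y) : H.Connected := by
  have hreach : ∀ a b, H.Reachable (f a) (f b) := fun a b => by
    obtain ⟨p⟩ := hG.preconnected a b
    induction p with
    | nil => exact Reachable.rfl
    | cons hadj _ ih => exact (hf _ _ hadj).trans ih
  have := hG.nonempty.map f
  refine ⟨fun y z => ?_⟩
  obtain ⟨a, ha⟩ := hsurj y
  obtain ⟨b, hb⟩ := hsurj z
  exact ha.symm.trans ((hreach a b).trans hb)

theorem IsAttached.connected_induce_iff {V : Type*} {G : SimpleGraph V}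
    {S : Set (V ⊕ G.edgeSet)} (h : IsAttached S) :
    ((fullSubdivision G).induce S).Connected ↔ (G.induce (Sum.inl ⁻¹' S)).Connected := by
  choose r hr hrS using h
  constructor
  · intro hc
    let f : S → ↥(Sum.inl ⁻¹' S : Set V) := fun x => match x with
      | ⟨Sum.inl u, hu⟩ => ⟨u, hu⟩
      | ⟨Sum.inr e, he⟩ => ⟨r e, (hrS e).2 he⟩
    have hstep : ∀ (u : V) (e : G.edgeSet) (hu : Sum.inl u ∈ S) (he : Sum.inr e ∈ S),
        u ∈ (e : Sym2 V) →
        (G.induce (Sum.inl ⁻¹' S)).Reachable (f ⟨Sum.inl u, hu⟩) (f ⟨Sum.inr e, he⟩) := by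
      intro u e hu he hue
      by_cases hne : u = r e
      · subst hne
        exact Reachable.rfl
      · refine Adj.reachable ?_
        have hadj := e.2
        rw [(Sym2.mem_and_mem_iff hne).1 ⟨hue, hr e⟩] at hadj
        exact hadj
    refine hc.of_adj_reachable f ?_ fun y => ⟨⟨Sum.inl y.1, y.2⟩, Reachable.rfl⟩
    rintro ⟨a, ha⟩ ⟨b, hb⟩ hab
    obtain ⟨u, e, hue, ⟨rfl, rfl⟩ | ⟨rfl, rfl⟩⟩ := fullSubdivision_adj.1 (induce_adj.1 hab)
    · exact hstep u e ha hb hue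
    · exact (hstep u e hb ha hue).symm
  · intro hc
    have hstep : ∀ (u : V) (e : G.edgeSet) (hu : Sum.inl u ∈ S) (he : Sum.inr e ∈ S),
        u ∈ (e : Sym2 V) →
        ((fullSubdivision G).induce S).Reachable ⟨Sum.inl u, hu⟩ ⟨Sum.inr e, he⟩ :=
      fun u e hu he hue => Adj.reachable (fullSubdivision_adj_inl_inr.2 hue)
    refine hc.of_adj_reachable (fun u => ⟨Sum.inl u.1, u.2⟩) ?_ ?_
    · rintro ⟨u, hu⟩ ⟨v, hv⟩ huv
      let e : G.edgeSet := ⟨s(u, v), huv⟩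
      have he : Sum.inr e ∈ S := by
        rw [← hrS e]
        rcases Sym2.mem_iff.1 (hr e) with h | h <;> rw [h] <;> assumption
      exact (hstep u e hu he (Sym2.mem_mk_left u v)).trans
        (hstep v e hv he (Sym2.mem_mk_right u v)).symm
    · rintro ⟨u | e, hy⟩
      · exact ⟨⟨u, hy⟩, Reachable.rfl⟩
      · exact ⟨⟨r e, (hrS e).2 hy⟩, hstep _ _ _ _ (hr e)⟩

theorem ncard_cutEdges_fullSubdivision_le_two {V : Type*} {G : SimpleGraph V}
    {S : Set (V ⊕ G.edgeSet)} (hc : ((fullSubdivision G).induce S).Connected) {e : G.edgeSet}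
    (he : Sum.inr e ∈ S) (hout : ∀ u ∈ (e : Sym2 V), Sum.inl u ∉ S) :
    (cutEdges (fullSubdivision G) S).ncard ≤ 2 := by
  have hS : ∀ x ∈ S, x = Sum.inr e := by
    intro x hx
    obtain ⟨p⟩ := hc.preconnected ⟨Sum.inr e, he⟩ ⟨x, hx⟩
    cases p with
    | nil => rfl
    | @cons _ b _ hadj _ =>
      obtain ⟨u, e', hue, ⟨h, -⟩ | ⟨h, hb⟩⟩ := fullSubdivision_adj.1 (induce_adj.1 hadj)
      · cases h
      · cases h
        exact absurd (hb ▸ b.2) (hout u hue)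
  obtain ⟨e, hE⟩ := e
  induction e with | _ a b
  let x : V → Sym2 (V ⊕ G.edgeSet) := fun u => s(Sum.inl u, Sum.inr ⟨s(a, b), hE⟩)
  have hsub : cutEdges (fullSubdivision G) S ⊆ {x a, x b} := by
    intro y hy
    obtain ⟨u, e', hue, hs, rfl⟩ := mem_cutEdges_fullSubdivision.1 hy
    have hu : Sum.inl u ∉ S := fun h => by cases hS _ h
    have he' : Sum.inr e' ∈ S := by tauto
    cases hS _ he'
    rcases Sym2.mem_iff.1 hue with rfl | rfl
    · exact Or.inl rfl
    · exact Or.inr rfl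
  exact (Set.ncard_le_ncard hsub).trans ((Set.ncard_insert_le _ _).trans (by rw [Set.ncard_singleton]))

theorem isAttached_of_two_lt_ncard {V : Type*} {G : SimpleGraph V} {S : Set (V ⊕ G.edgeSet)}
    (hc : ((fullSubdivision G).induce S).Connected)
    (hc' : ((fullSubdivision G).induce Sᶜ).Connected)
    (hcard : 2 < (cutEdges (fullSubdivision G) S).ncard) : IsAttached S := by
  intro e
  by_contra! hne
  refine hcard.not_ge ?_
  by_cases he : Sum.inr e ∈ S
  · exact ncard_cutEdges_fullSubdivision_le_two hc he fun u hu => by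
      have := hne u hu
      tauto
  · rw [← cutEdges_compl]
    exact ncard_cutEdges_fullSubdivision_le_two hc' he fun u hu => by
      have := hne u hu
      simp only [Set.mem_compl_iff]
      tauto

/-- The cut of the full subdivision in which a subdivision vertex joins the side of `S` as soon as
one of its neighbours lies in `S`. -/
def subdivisionSide {V : Type*} (G : SimpleGraph V) (S : Set V) : Set (V ⊕ G.edgeSet) :=
  {x | Sum.elim (· ∈ S) (fun e : G.edgeSet => ∃ u ∈ (e : Sym2 V), u ∈ S) x}

theorem isAttached_subdivisionSide {V : Type*} (G : SimpleGraph V) (S : Set V) :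
    IsAttached (subdivisionSide G S) := by
  intro e
  by_cases h : ∃ u ∈ (e : Sym2 V), u ∈ S
  · obtain ⟨u, hu, huS⟩ := h
    exact ⟨u, hu, iff_of_true huS ⟨u, hu, huS⟩⟩
  · exact ⟨_, Sym2.out_fst_mem _, iff_of_false (fun h' => h ⟨_, Sym2.out_fst_mem _, h'⟩) h⟩

theorem stmt1 {V : Type*} [Fintype V] (G : SimpleGraph V) (k : ℕ) (hk : 2 < k) :
    (∃ S₁ S₂ : Set V, S₁ ∪ S₂ = Set.univ ∧ S₁ ∩ S₂ = ∅ ∧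
        S₁.Nonempty ∧ S₂.Nonempty ∧
        (G.induce S₁).Connected ∧ (G.induce S₂).Connected ∧
        k ≤ (cutEdges G S₁).ncard) ↔
      (∃ S₁' S₂' : Set (V ⊕ G.edgeSet), S₁' ∪ S₂' = Set.univ ∧ S₁' ∩ S₂' = ∅ ∧
        S₁'.Nonempty ∧ S₂'.Nonempty ∧
        ((fullSubdivision G).induce S₁').Connected ∧
        ((fullSubdivision G).induce S₂').Connected ∧
        k ≤ (cutEdges (fullSubdivision G) S₁').ncard) := by
  constructor
  · rintro ⟨S, T, hun, hin, -, -, hS, hT, hcard⟩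
    obtain rfl : Sᶜ = T := (isCompl_iff.2
      ⟨Set.disjoint_iff_inter_eq_empty.2 hin, codisjoint_iff.2 hun⟩).compl_eq
    have h := isAttached_subdivisionSide G S
    have hS' := h.connected_induce_iff.2 hS
    have hT' := h.compl.connected_induce_iff.2 hT
    exact ⟨_, _, Set.union_compl_self _, Set.inter_compl_self _,
      Set.nonempty_coe_sort.1 hS'.nonempty, Set.nonempty_coe_sort.1 hT'.nonempty, hS', hT',
      hcard.trans_eq h.ncard_cutEdges.symm⟩
  · rintro ⟨S, T, hun, hin, -, -, hS, hT, hcard⟩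
    obtain rfl : Sᶜ = T := (isCompl_iff.2
      ⟨Set.disjoint_iff_inter_eq_empty.2 hin, codisjoint_iff.2 hun⟩).compl_eq
    have h := isAttached_of_two_lt_ncard hS hT (hk.trans_le hcard)
    have hS' := h.connected_induce_iff.1 hS
    have hT' := h.compl.connected_induce_iff.1 hT
    exact ⟨_, _, Set.union_compl_self _, Set.inter_compl_self _,
      Set.nonempty_coe_sort.1 hS'.nonempty, Set.nonempty_coe_sort.1 hT'.nonempty, hS', hT',
      hcard.trans_eq h.ncard_cutEdges⟩
end

section
/- Let n ≥ 1 and m ≥ 2n be integers, let X be a set with |X| = 3n, let F₁,…,F_m ⊆ X be subsets each of size exactly 3, let M ≥ 1 be an integer, and let G be the Exact-3-Cover gadget graph built from this data. Suppose F' ⊆ {1,…,m} indexes an exact cover, i.e., every element of X belongs to F_i for exactly one i ∈ F'. Let S = {u_i : i ∈ F'} ∪ {u_i : m+1 ≤ i ≤ 2(m−n)} ∪ X. Then S is nonempty, the induced subgraph G[S] is connected, and the number of edges of G with exactly one endpoint in S is exactly (m−n)² + (3m−3n) + (m−2n)·M. -/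
/-- The vertex set of the Exact-3-Cover gadget graph: the clique vertices
`u₁, …, u_{2(m−n)}` (0-indexed), the ground set `X`, and the pendant sets
`Y_{m+1}, …, Y_{2(m−n)}`, each of size `M` (indexed by `Fin (m − 2n) × Fin M`). -/
abbrev XCVert (n m M : ℕ) (X : Type*) : Type _ :=
  Fin (2 * (m - n)) ⊕ (X ⊕ (Fin (m - 2 * n) × Fin M))

/-- The Exact-3-Cover gadget graph: `U` is a clique, `u_i` (for `i < m`, 0-indexed) is
adjacent to exactly the elements of `F i`, and `u_{m+j}` is adjacent to exactly the `M`
vertices of the pendant block `Y_j`; `X ∪ Y` is an independent set. -/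
def xcGadget (n m M : ℕ) (X : Type*) (F : ℕ → Finset X) :
    SimpleGraph (XCVert n m M X) :=
  SimpleGraph.fromRel (fun a b =>
    (∃ i j : Fin (2 * (m - n)), a = Sum.inl i ∧ b = Sum.inl j) ∨
    (∃ (i : Fin (2 * (m - n))) (x : X),
      a = Sum.inl i ∧ b = Sum.inr (Sum.inl x) ∧ (i : ℕ) < m ∧ x ∈ F (i : ℕ)) ∨
    (∃ (i : Fin (2 * (m - n))) (p : Fin (m - 2 * n) × Fin M),
      a = Sum.inl i ∧ b = Sum.inr (Sum.inr p) ∧ (i : ℕ) = m + (p.1 : ℕ)))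

/-- A cut has as many edges as there are adjacent pairs leading from `S` to its complement. -/
theorem ncard_cutEdges {V : Type*} (G : SimpleGraph V) (S : Set V) :
    (cutEdges G S).ncard = {p : V × V | p.1 ∈ S ∧ p.2 ∉ S ∧ G.Adj p.1 p.2}.ncard := by
  have himage : cutEdges G S =
      (fun p : V × V => s(p.1, p.2)) '' {p | p.1 ∈ S ∧ p.2 ∉ S ∧ G.Adj p.1 p.2} := by
    ext e
    constructor
    · rintro ⟨he, u, hu, v, hv, rfl⟩
      exact ⟨(u, v), ⟨hu, hv, he⟩, rfl⟩
    · rintro ⟨⟨u, v⟩, ⟨hu, hv, h⟩, rfl⟩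
      exact ⟨h, u, hu, v, hv, rfl⟩
  rw [himage]
  refine Set.InjOn.ncard_image ?_
  rintro ⟨a, b⟩ ⟨ha, hb, -⟩ ⟨c, d⟩ ⟨hc, hd, -⟩ h
  rcases Sym2.eq_iff.mp h with ⟨rfl, rfl⟩ | ⟨rfl, rfl⟩
  · rfl
  · exact absurd ha hd

section Adjacency

variable {n m M : ℕ} {X : Type*} {F : ℕ → Finset X}

theorem xcGadget_adj_inl_inl {i j : Fin (2 * (m - n))} :
    (xcGadget n m M X F).Adj (Sum.inl i) (Sum.inl j) ↔ i ≠ j := by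
  simp [xcGadget]

theorem xcGadget_adj_inl_ground {i : Fin (2 * (m - n))} {x : X} :
    (xcGadget n m M X F).Adj (Sum.inl i) (Sum.inr (Sum.inl x)) ↔
      (i : ℕ) < m ∧ x ∈ F i := by
  simp [xcGadget]

theorem xcGadget_adj_inl_pendant {i : Fin (2 * (m - n))} {p : Fin (m - 2 * n) × Fin M} :
    (xcGadget n m M X F).Adj (Sum.inl i) (Sum.inr (Sum.inr p)) ↔
      (i : ℕ) = m + (p.1 : ℕ) := by
  obtain ⟨j, k⟩ := p
  simp [xcGadget]

theorem xcGadget_not_adj_inr_inr {a b : X ⊕ (Fin (m - 2 * n) × Fin M)} :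
    ¬ (xcGadget n m M X F).Adj (Sum.inr a) (Sum.inr b) := by
  simp [xcGadget]

end Adjacency

/-- An exact cover of a `3n`-element set by triples has `n` members. -/
theorem card_of_exactCover {n m : ℕ} {X : Type*} [Fintype X] (hX : Fintype.card X = 3 * n)
    {F : ℕ → Finset X} (hF : ∀ i < m, (F i).card = 3)
    {F' : Finset ℕ} (hF' : F' ⊆ Finset.range m)
    (hcover : ∀ x : X, ∃! i, i ∈ F' ∧ x ∈ F i) : F'.card = n := by
  classical
  have hunion : F'.biUnion F = Finset.univ := by
    ext x
    obtain ⟨i, hi, -⟩ := hcover x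
    simpa using ⟨i, hi⟩
  have hdisj : (F' : Set ℕ).PairwiseDisjoint F := by
    intro i hi j hj hij
    refine Finset.disjoint_left.mpr fun x hxi hxj => hij ?_
    exact (hcover x).unique ⟨hi, hxi⟩ ⟨hj, hxj⟩
  have hcard := Finset.card_biUnion hdisj
  rw [hunion, Finset.card_univ, hX,
    Finset.sum_congr rfl fun i hi => hF i (Finset.mem_range.mp (hF' hi))] at hcard
  simp only [Finset.sum_const, smul_eq_mul] at hcard
  omega

/-- Exactly `m - k` of the indices below `N ≥ m` lie below `m` and outside a given
`k`-element subset of `{0, …, m - 1}`. -/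
theorem card_filter_lt_notMem {m N : ℕ} (hN : m ≤ N) {F' : Finset ℕ}
    (hF' : F' ⊆ Finset.range m) :
    (Finset.univ.filter fun i : Fin N => (i : ℕ) < m ∧ (i : ℕ) ∉ F').card = m - F'.card := by
  have himage : (Finset.univ.filter fun i : Fin N => (i : ℕ) < m ∧ (i : ℕ) ∉ F').map
      Fin.valEmbedding = Finset.range m \ F' := by
    ext i
    simp only [Finset.mem_map, Finset.mem_filter, Finset.mem_univ, true_and, Finset.mem_sdiff,
      Finset.mem_range, Fin.valEmbedding_apply]
    constructor
    · rintro ⟨j, hj, rfl⟩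
      exact hj
    · intro hi
      exact ⟨⟨i, by omega⟩, hi, rfl⟩
  rw [← Finset.card_map Fin.valEmbedding, himage, Finset.card_sdiff_of_subset hF',
    Finset.card_range]

/-- The subgraph induced on the vertices of a cover, the pendant-bearing clique vertices and the
ground set is connected. -/
theorem xcGadget_induce_connected {n m M : ℕ} (hm : 2 * n ≤ m) {X : Type*} [Nonempty X]
    {F : ℕ → Finset X} {F' : Finset ℕ} (hF' : F' ⊆ Finset.range m)
    (hcover : ∀ x : X, ∃ i, i ∈ F' ∧ x ∈ F i) {S : Set (XCVert n m M X)}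
    (hinl : ∀ i, Sum.inl i ∈ S ↔ (i : ℕ) ∈ F' ∨ m ≤ (i : ℕ))
    (hpendant : ∀ p, Sum.inr (Sum.inr p) ∉ S) :
    ((xcGadget n m M X F).induce S).Connected := by
  have hcover' : ∀ x : X, ∃ i : Fin (2 * (m - n)), (i : ℕ) ∈ F' ∧ (i : ℕ) < m ∧ x ∈ F i := by
    intro x
    obtain ⟨i, hi, hx⟩ := hcover x
    have him := Finset.mem_range.mp (hF' hi)
    exact ⟨⟨i, by omega⟩, hi, him, hx⟩
  obtain ⟨c, hc, -, -⟩ := hcover' (Classical.arbitrary X)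
  have hcS : (Sum.inl c : XCVert n m M X) ∈ S := (hinl c).mpr (Or.inl hc)
  have hclique : ∀ (i : Fin (2 * (m - n))) (hi : Sum.inl i ∈ S),
      ((xcGadget n m M X F).induce S).Reachable ⟨Sum.inl c, hcS⟩ ⟨Sum.inl i, hi⟩ := by
    intro i hi
    by_cases h : c = i
    · subst h
      exact SimpleGraph.Reachable.refl _
    · refine SimpleGraph.Adj.reachable ?_
      exact xcGadget_adj_inl_inl.mpr h
  refine (SimpleGraph.connected_iff_exists_forall_reachable _).mpr ⟨⟨Sum.inl c, hcS⟩, ?_⟩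
  rintro ⟨i | x | p, hv⟩
  · exact hclique i hv
  · obtain ⟨i, hi, him, hx⟩ := hcover' x
    refine (hclique i ((hinl i).mpr (Or.inl hi))).trans (SimpleGraph.Adj.reachable ?_)
    exact xcGadget_adj_inl_ground.mpr ⟨him, hx⟩
  · exact absurd hv (hpendant p)

/-- The cut pairs of the gadget split into clique edges, edges at the ground set and edges at the
pendant blocks. -/
theorem ncard_cutEdges_xcGadget {n m M : ℕ} (hm : 2 * n ≤ m) {X : Type*}
    {F : ℕ → Finset X} (hF : ∀ i < m, (F i).card = 3)
    {F' : Finset ℕ} (hF' : F' ⊆ Finset.range m) (hcard : F'.card = n)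
    {S : Set (XCVert n m M X)}
    (hinl : ∀ i, Sum.inl i ∈ S ↔ (i : ℕ) ∈ F' ∨ m ≤ (i : ℕ))
    (hground : ∀ x, Sum.inr (Sum.inl x) ∈ S)
    (hpendant : ∀ p, Sum.inr (Sum.inr p) ∉ S) :
    (cutEdges (xcGadget n m M X F) S).ncard =
      (m - n) ^ 2 + (3 * m - 3 * n) + (m - 2 * n) * M := by
  classical
  let B : Finset (Fin (2 * (m - n))) :=
    Finset.univ.filter fun i => (i : ℕ) < m ∧ (i : ℕ) ∉ F'
  have hmemB : ∀ i, i ∈ B ↔ (i : ℕ) < m ∧ (i : ℕ) ∉ F' := fun i => by simp [B]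
  have hB : B.card = m - n :=
    (card_filter_lt_notMem (by omega) hF').trans (by rw [hcard])
  have hBc : Bᶜ.card = m - n := by
    rw [Finset.card_compl, Fintype.card_fin, hB]
    omega
  have hinlB : ∀ i, Sum.inl i ∈ S ↔ i ∉ B := by
    intro i
    rw [hinl, hmemB]
    by_cases h : (i : ℕ) ∈ F' <;> simp [h]
  let cliquePair : Fin (2 * (m - n)) × Fin (2 * (m - n)) ↪ XCVert n m M X × XCVert n m M X :=
    ⟨fun p => (Sum.inl p.1, Sum.inl p.2), by
      rintro ⟨a, b⟩ ⟨c, d⟩ h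
      simpa using h⟩
  let groundPair : (Σ _ : Fin (2 * (m - n)), X) ↪ XCVert n m M X × XCVert n m M X :=
    ⟨fun p => (Sum.inr (Sum.inl p.2), Sum.inl p.1), by
      rintro ⟨a, b⟩ ⟨c, d⟩ h
      simp only [Prod.mk.injEq, Sum.inr.injEq, Sum.inl.injEq] at h
      rw [h.1, h.2]⟩
  let pendantPair : Fin (m - 2 * n) × Fin M ↪ XCVert n m M X × XCVert n m M X :=
    ⟨fun p => (Sum.inl ⟨m + (p.1 : ℕ), by omega⟩, Sum.inr (Sum.inr p)), by
      intro p q h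
      simpa using congrArg Prod.snd h⟩
  have hpairs : {p : XCVert n m M X × XCVert n m M X |
      p.1 ∈ S ∧ p.2 ∉ S ∧ (xcGadget n m M X F).Adj p.1 p.2} =
      (((Bᶜ ×ˢ B).map cliquePair ∪ (B.sigma fun i => F i).map groundPair) ∪
        Finset.univ.map pendantPair : Finset _) := by
    ext ⟨u, v⟩
    simp only [Set.mem_ofPred_eq, Finset.coe_union, Set.mem_union, Finset.mem_coe,
      Finset.mem_map, Finset.mem_product, Finset.mem_sigma, Finset.mem_univ, true_and,
      Finset.mem_compl]
    constructor
    · rintro ⟨hu, hv, h⟩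
      rcases u with i | x | p
      · rcases v with j | y | q
        · exact Or.inl (Or.inl ⟨(i, j), ⟨(hinlB i).mp hu, not_not.mp (mt (hinlB j).mpr hv)⟩, rfl⟩)
        · exact absurd (hground y) hv
        · refine Or.inr ⟨q, ?_⟩
          have hi : i = ⟨m + (q.1 : ℕ), by omega⟩ := Fin.ext (xcGadget_adj_inl_pendant.mp h)
          rw [hi]
          rfl
      · rcases v with j | b
        · exact Or.inl (Or.inr ⟨⟨j, x⟩, ⟨not_not.mp (mt (hinlB j).mpr hv),
            (xcGadget_adj_inl_ground.mp h.symm).2⟩, rfl⟩)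
        · exact absurd h xcGadget_not_adj_inr_inr
      · exact absurd hu (hpendant p)
    · rintro ((⟨⟨i, j⟩, ⟨hi, hj⟩, h⟩ | ⟨⟨j, x⟩, ⟨hj, hx⟩, h⟩) | ⟨q, h⟩) <;>
        obtain ⟨rfl, rfl⟩ := Prod.mk.inj h
      · refine ⟨(hinlB i).mpr hi, fun h => (hinlB j).mp h hj, xcGadget_adj_inl_inl.mpr ?_⟩
        exact (ne_of_mem_of_not_mem hj hi).symm
      · exact ⟨hground x, fun h => (hinlB j).mp h hj,
          (xcGadget_adj_inl_ground.mpr ⟨((hmemB j).mp hj).1, hx⟩).symm⟩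
      · exact ⟨(hinl _).mpr (Or.inr (Nat.le_add_right _ _)), hpendant q,
          xcGadget_adj_inl_pendant.mpr rfl⟩
  have hdisj : Disjoint ((Bᶜ ×ˢ B).map cliquePair) ((B.sigma fun i => F i).map groundPair) := by
    simp only [Finset.disjoint_left, Finset.mem_map]
    rintro _ ⟨p, -, rfl⟩ ⟨q, -, h⟩
    cases congrArg Prod.fst h
  have hdisj' : Disjoint ((Bᶜ ×ˢ B).map cliquePair ∪ (B.sigma fun i => F i).map groundPair)
      (Finset.univ.map pendantPair) := by
    simp only [Finset.disjoint_left, Finset.mem_union, Finset.mem_map]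
    rintro _ (⟨p, -, rfl⟩ | ⟨p, -, rfl⟩) ⟨q, -, h⟩ <;> cases congrArg Prod.snd h
  have hsum : ∑ i ∈ B, (F i).card = 3 * m - 3 * n := by
    have htriple : ∀ i ∈ B, (F i).card = 3 := fun i hi => hF i ((hmemB i).mp hi).1
    rw [Finset.sum_const_nat htriple, hB]
    omega
  rw [ncard_cutEdges, hpairs, Set.ncard_coe_finset, Finset.card_union_of_disjoint hdisj',
    Finset.card_union_of_disjoint hdisj, Finset.card_map, Finset.card_map, Finset.card_map,
    Finset.card_product, Finset.card_sigma, hB, hBc, hsum, Finset.card_univ, Fintype.card_prod,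
    Fintype.card_fin, Fintype.card_fin, sq]

theorem stmt4 (n m M : ℕ) (hn : 1 ≤ n) (hm : 2 * n ≤ m) (hM : 1 ≤ M)
    (X : Type*) [Fintype X] (hX : Fintype.card X = 3 * n)
    (F : ℕ → Finset X) (hF : ∀ i < m, (F i).card = 3)
    (F' : Finset ℕ) (hF' : F' ⊆ Finset.range m)
    (hcover : ∀ x : X, ∃! i, i ∈ F' ∧ x ∈ F i)
    (S : Set (XCVert n m M X))
    (hS : S = (Sum.inl '' {i : Fin (2 * (m - n)) | (i : ℕ) ∈ F' ∨ m ≤ (i : ℕ)}) ∪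
      {v | ∃ x : X, v = Sum.inr (Sum.inl x)}) :
    S.Nonempty ∧ ((xcGadget n m M X F).induce S).Connected ∧
      (cutEdges (xcGadget n m M X F) S).ncard =
        (m - n) ^ 2 + (3 * m - 3 * n) + (m - 2 * n) * M := by
  have hinl : ∀ i, Sum.inl i ∈ S ↔ (i : ℕ) ∈ F' ∨ m ≤ (i : ℕ) := by simp [hS]
  have hground : ∀ x, Sum.inr (Sum.inl x) ∈ S := by simp [hS]
  have hpendant : ∀ p, Sum.inr (Sum.inr p) ∉ S := by simp [hS]
  have : Nonempty X := Fintype.card_pos_iff.mp (by omega)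
  exact ⟨⟨_, hground (Classical.arbitrary X)⟩,
    xcGadget_induce_connected hm hF' (fun x => (hcover x).exists) hinl hpendant,
    ncard_cutEdges_xcGadget hm hF hF' (card_of_exactCover hX hF hF' hcover) hinl hground hpendant⟩
end

section
/- Let φ be a CNF formula over variables x₁,…,x_n (n ≥ 1) with clauses C₁,…,C_m (m ≥ 1), where each clause is a set of exactly three literals over three pairwise distinct variables. For a positive integer q, put K = q² and let H_φ^q be the SAT gadget graph built from φ and q. Then there exists a positive integer K₀ (depending on n and m) such that for every q ≥ K₀: φ is satisfiable if and only if H_φ^q has a connected cut of size at least m·q + n·q⁴ + (2n−1)·q² + 2(n−1), i.e., there is a nonempty set S of vertices of H_φ^q such that the induced subgraph H_φ^q[S] is connected and at least m·q + n·q⁴ + (2n−1)·q² + 2(n−1) edges of H_φ^q have exactly one endpoint in S. -/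
/-- Vertices of the SAT gadget graph `H_φ^q` (with `K = q²`): literal vertices
`(i, b) : Fin n × Bool`, helper vertices `Fin n × Fin (q²)`, pendants of helper vertices
`Fin n × Fin (q²) × Fin (q²)`, clause vertices `Fin m`, pendants of clause vertices
`Fin m × Fin q`, bridge vertices `Fin (n-1)`, and pendants of bridge vertices
`Fin (n-1) × Fin (q²)`. -/
abbrev SatVert (n m q : ℕ) : Type :=
  (Fin n × Bool) ⊕ ((Fin n × Fin (q ^ 2)) ⊕ ((Fin n × Fin (q ^ 2) × Fin (q ^ 2)) ⊕
    (Fin m ⊕ ((Fin m × Fin q) ⊕ (Fin (n - 1) ⊕ (Fin (n - 1) × Fin (q ^ 2)))))))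

/-- The SAT gadget graph `H_φ^q`, for a formula with clauses `C : Fin m → Finset (Fin n × Bool)`
(a literal is a pair of a variable index and a polarity). Each helper vertex `h^i_k` is adjacent
to both literal vertices of variable `i` and to its own `K = q²` pendant vertices; each clause
vertex `v(C_j)` is adjacent to the literal vertices of the literals of `C_j` and to its own `q`
pendant vertices; each bridge vertex `b_i` is adjacent to the four literal vertices of variables
`i` and `i+1` and to its own `K` pendant vertices. -/
def satGadget (n m q : ℕ) (C : Fin m → Finset (Fin n × Bool)) :
    SimpleGraph (SatVert n m q) :=
  SimpleGraph.fromRel (fun a b =>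
    -- helper vertex ~ literal vertex of the same variable
    (∃ (i : Fin n) (k : Fin (q ^ 2)) (pol : Bool),
      a = Sum.inr (Sum.inl (i, k)) ∧ b = Sum.inl (i, pol)) ∨
    -- helper vertex ~ its pendant vertices
    (∃ (i : Fin n) (k k' : Fin (q ^ 2)),
      a = Sum.inr (Sum.inr (Sum.inl (i, k, k'))) ∧ b = Sum.inr (Sum.inl (i, k))) ∨
    -- clause vertex ~ literal vertices of its literals
    (∃ (j : Fin m) (l : Fin n × Bool), l ∈ C j ∧
      a = Sum.inr (Sum.inr (Sum.inr (Sum.inl j))) ∧ b = Sum.inl l) ∨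
    -- clause vertex ~ its pendant vertices
    (∃ (j : Fin m) (p : Fin q),
      a = Sum.inr (Sum.inr (Sum.inr (Sum.inr (Sum.inl (j, p))))) ∧
      b = Sum.inr (Sum.inr (Sum.inr (Sum.inl j)))) ∨
    -- bridge vertex ~ the four literal vertices of variables i and i+1
    (∃ (i : Fin (n - 1)) (l : Fin n × Bool),
      ((l.1 : ℕ) = (i : ℕ) ∨ (l.1 : ℕ) = (i : ℕ) + 1) ∧
      a = Sum.inr (Sum.inr (Sum.inr (Sum.inr (Sum.inr (Sum.inl i))))) ∧ b = Sum.inl l) ∨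
    -- bridge vertex ~ its pendant vertices
    (∃ (i : Fin (n - 1)) (k : Fin (q ^ 2)),
      a = Sum.inr (Sum.inr (Sum.inr (Sum.inr (Sum.inr (Sum.inr (i, k)))))) ∧
      b = Sum.inr (Sum.inr (Sum.inr (Sum.inr (Sum.inr (Sum.inl i)))))))

namespace SatGadget

variable {n m q : ℕ} {C : Fin m → Finset (Fin n × Bool)}

/-- The literal vertices. -/
abbrev lit (l : Fin n × Bool) : SatVert n m q := Sum.inl l

/-- The helper vertices. -/
abbrev helper (i : Fin n) (k : Fin (q ^ 2)) : SatVert n m q := Sum.inr (Sum.inl (i, k))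

/-- The pendant vertices of helper vertices. -/
abbrev helperPendant (i : Fin n) (k k' : Fin (q ^ 2)) : SatVert n m q :=
  Sum.inr (Sum.inr (Sum.inl (i, k, k')))

/-- The clause vertices. -/
abbrev clause (j : Fin m) : SatVert n m q := Sum.inr (Sum.inr (Sum.inr (Sum.inl j)))

/-- The pendant vertices of clause vertices. -/
abbrev clausePendant (j : Fin m) (p : Fin q) : SatVert n m q :=
  Sum.inr (Sum.inr (Sum.inr (Sum.inr (Sum.inl (j, p)))))

/-- The bridge vertices. -/
abbrev bridge (i : Fin (n - 1)) : SatVert n m q :=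
  Sum.inr (Sum.inr (Sum.inr (Sum.inr (Sum.inr (Sum.inl i)))))

/-- The pendant vertices of bridge vertices. -/
abbrev bridgePendant (i : Fin (n - 1)) (k : Fin (q ^ 2)) : SatVert n m q :=
  Sum.inr (Sum.inr (Sum.inr (Sum.inr (Sum.inr (Sum.inr (i, k))))))

/-- The variable on the left (`s = false`) or on the right (`s = true`) of a bridge. -/
def bridgeVar (i : Fin (n - 1)) (s : Bool) : Fin n :=
  ⟨i + s.toNat, by have := i.2; have := s.toNat_le; omega⟩

/-- An index type for the edges of the gadget graph. -/
abbrev Edge (n m q : ℕ) (C : Fin m → Finset (Fin n × Bool)) : Type :=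
  (Fin n × Fin (q ^ 2) × Bool) ⊕ ((Fin n × Fin (q ^ 2) × Fin (q ^ 2)) ⊕
    (((j : Fin m) × C j) ⊕ ((Fin m × Fin q) ⊕
      ((Fin (n - 1) × Bool × Bool) ⊕ (Fin (n - 1) × Fin (q ^ 2))))))

/-- The endpoint of an edge that is a pendant vertex or, failing that, not a literal vertex. -/
def Edge.src : Edge n m q C → SatVert n m q
  | .inl (i, k, _) => helper i k
  | .inr (.inl (i, k, k')) => helperPendant i k k'
  | .inr (.inr (.inl ⟨j, _⟩)) => clause j
  | .inr (.inr (.inr (.inl (j, p)))) => clausePendant j p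
  | .inr (.inr (.inr (.inr (.inl (i, _, _))))) => bridge i
  | .inr (.inr (.inr (.inr (.inr (i, k))))) => bridgePendant i k

/-- The endpoint of an edge other than `Edge.src`. -/
def Edge.tgt : Edge n m q C → SatVert n m q
  | .inl (i, _, b) => lit (i, b)
  | .inr (.inl (i, k, _)) => helper i k
  | .inr (.inr (.inl ⟨_, l⟩)) => lit l
  | .inr (.inr (.inr (.inl (j, _)))) => clause j
  | .inr (.inr (.inr (.inr (.inl (i, s, b))))) => lit (bridgeVar i s, b)
  | .inr (.inr (.inr (.inr (.inr (i, _))))) => bridge i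

lemma adj_iff {x y : SatVert n m q} : (satGadget n m q C).Adj x y ↔
    ∃ e : Edge n m q C, (x = e.src ∧ y = e.tgt) ∨ (y = e.src ∧ x = e.tgt) := by
  have key (a b : SatVert n m q) : ((∃ (i : Fin n) (k : Fin (q ^ 2)) (pol : Bool),
      a = helper i k ∧ b = lit (i, pol)) ∨
    (∃ (i : Fin n) (k k' : Fin (q ^ 2)), a = helperPendant i k k' ∧ b = helper i k) ∨
    (∃ (j : Fin m) (l : Fin n × Bool), l ∈ C j ∧ a = clause j ∧ b = lit l) ∨
    (∃ (j : Fin m) (p : Fin q), a = clausePendant j p ∧ b = clause j) ∨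
    (∃ (i : Fin (n - 1)) (l : Fin n × Bool),
      ((l.1 : ℕ) = (i : ℕ) ∨ (l.1 : ℕ) = (i : ℕ) + 1) ∧ a = bridge i ∧ b = lit l) ∨
    (∃ (i : Fin (n - 1)) (k : Fin (q ^ 2)), a = bridgePendant i k ∧ b = bridge i)) ↔
      ∃ e : Edge n m q C, a = e.src ∧ b = e.tgt := by
    constructor
    · rintro (⟨i, k, b, rfl, rfl⟩ | ⟨i, k, k', rfl, rfl⟩ | ⟨j, l, hl, rfl, rfl⟩ |
        ⟨j, p, rfl, rfl⟩ | ⟨i, ⟨v, b⟩, h | h, rfl, rfl⟩ | ⟨i, k, rfl, rfl⟩)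
      · exact ⟨.inl (i, k, b), rfl, rfl⟩
      · exact ⟨.inr (.inl (i, k, k')), rfl, rfl⟩
      · exact ⟨.inr (.inr (.inl ⟨j, l, hl⟩)), rfl, rfl⟩
      · exact ⟨.inr (.inr (.inr (.inl (j, p)))), rfl, rfl⟩
      · refine ⟨.inr (.inr (.inr (.inr (.inl (i, false, b))))), rfl, ?_⟩
        simpa [Edge.tgt, bridgeVar, Fin.ext_iff] using h
      · refine ⟨.inr (.inr (.inr (.inr (.inl (i, true, b))))), rfl, ?_⟩
        simpa [Edge.tgt, bridgeVar, Fin.ext_iff] using h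
      · exact ⟨.inr (.inr (.inr (.inr (.inr (i, k))))), rfl, rfl⟩
    · rintro ⟨⟨i, k, b⟩ | ⟨i, k, k'⟩ | ⟨j, l, hl⟩ | ⟨j, p⟩ | ⟨i, s, b⟩ | ⟨i, k⟩, rfl, rfl⟩ <;>
        simp [Edge.src, Edge.tgt]
      · exact hl
      · cases s <;> simp [bridgeVar]
  have ne (e : Edge n m q C) : e.src ≠ e.tgt := by
    rcases e with ⟨i, k, b⟩ | ⟨i, k, k'⟩ | ⟨j, l, hl⟩ | ⟨j, p⟩ | ⟨i, s, b⟩ | ⟨i, k⟩ <;>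
      simp [Edge.src, Edge.tgt]
  simp only [satGadget, SimpleGraph.fromRel_adj, key]
  constructor
  · rintro ⟨-, ⟨e, h⟩ | ⟨e, h⟩⟩
    exacts [⟨e, .inl h⟩, ⟨e, .inr h⟩]
  · rintro ⟨e, ⟨rfl, rfl⟩ | ⟨rfl, rfl⟩⟩
    exacts [⟨ne e, .inl ⟨e, rfl, rfl⟩⟩, ⟨(ne e).symm, .inr ⟨e, rfl, rfl⟩⟩]

lemma edge_injective :
    Function.Injective fun e : Edge n m q C => s(e.src, e.tgt) := by
  have hs : ∀ (i : Fin (n - 1)) (s s' : Bool), bridgeVar i s = bridgeVar i s' → s = s' := by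
    intro i s s' h
    cases s <;> cases s' <;> simp [bridgeVar] at h ⊢
  rintro (⟨i, k, b⟩ | ⟨i, k, k'⟩ | ⟨j, l, hl⟩ | ⟨j, p⟩ | ⟨i, s, b⟩ | ⟨i, k⟩)
    (⟨i', k₁, b'⟩ | ⟨i', k₁, k₁'⟩ | ⟨j', l', hl'⟩ | ⟨j', p'⟩ | ⟨i', s', b'⟩ | ⟨i', k₁⟩) h <;>
    simp [Edge.src, Edge.tgt] at h ⊢
  · tauto
  · tauto
  · obtain ⟨rfl, rfl⟩ := h
    simp
  · tauto
  · obtain ⟨rfl, h, rfl⟩ := h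
    simpa using hs _ _ _ h
  · tauto

open Classical in
/-- `1` if exactly one of `u`, `v` lies in `S`, and `0` otherwise. -/
noncomputable def cross (S : Set (SatVert n m q)) (u v : SatVert n m q) : ℕ :=
  if u ∈ S ↔ v ∈ S then 0 else 1

lemma cross_le_one (S : Set (SatVert n m q)) (u v : SatVert n m q) : cross S u v ≤ 1 := by
  unfold cross; split_ifs <;> simp

lemma ncard_cutEdges (S : Set (SatVert n m q)) :
    (cutEdges (satGadget n m q C) S).ncard =
      (∑ i, ∑ k, (∑ b, cross S (helper i k) (lit (i, b)) +
        ∑ k', cross S (helperPendant i k k') (helper i k))) +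
      (∑ j, (∑ l : C j, cross S (clause j) (lit l) +
        ∑ p, cross S (clausePendant j p) (clause j))) +
      ∑ i, (∑ s, ∑ b, cross S (bridge i) (lit (bridgeVar i s, b)) +
        ∑ k, cross S (bridgePendant i k) (bridge i)) := by
  classical
  have h : cutEdges (satGadget n m q C) S = (fun e : Edge n m q C => s(e.src, e.tgt)) ''
      {e | ¬ (e.src ∈ S ↔ e.tgt ∈ S)} := by
    ext e
    constructor
    · rintro ⟨he, u, hu, v, hv, rfl⟩
      obtain ⟨e, ⟨rfl, rfl⟩ | ⟨rfl, rfl⟩⟩ := adj_iff.1 he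
      · exact ⟨e, by simp [hu, hv], rfl⟩
      · exact ⟨e, by simp [hu, hv], Sym2.eq_swap⟩
    · rintro ⟨e, he, rfl⟩
      refine ⟨adj_iff.2 ⟨e, .inl ⟨rfl, rfl⟩⟩, ?_⟩
      by_cases hs : e.src ∈ S
      · exact ⟨_, hs, _, fun ht => he (by simp [hs, ht]), rfl⟩
      · exact ⟨_, by_contra fun ht => he (by simp [hs, ht]), _, hs, Sym2.eq_swap⟩
  have hsum : {e : Edge n m q C | ¬ (e.src ∈ S ↔ e.tgt ∈ S)}.ncard =
      ∑ e : Edge n m q C, cross S e.src e.tgt := by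
    rw [Set.ncard_eq_toFinset_card', Set.toFinset_ofPred, Finset.card_filter]
    refine Finset.sum_congr rfl fun e _ => ?_
    by_cases h : e.src ∈ S ↔ e.tgt ∈ S <;> simp [cross, h]
  rw [h, Set.ncard_image_of_injective _ edge_injective, hsum]
  simp only [Fintype.sum_sum_type, Fintype.sum_prod_type, Fintype.sum_sigma, Edge.src, Edge.tgt,
    Finset.sum_add_distrib]
  ring

/-- The set `S` crosses the boundary of any `A` separating two of its points. -/
lemma exists_adj_of_mem_of_notMem {V : Type*} {G : SimpleGraph V} {S : Set V}
    (hS : (G.induce S).Connected) (A : Set V) {u v : V} (hu : u ∈ S) (hv : v ∈ S)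
    (huA : u ∈ A) (hvA : v ∉ A) : ∃ x ∈ S, ∃ y ∈ S, x ∈ A ∧ y ∉ A ∧ G.Adj x y := by
  obtain ⟨w⟩ := hS.preconnected ⟨u, hu⟩ ⟨v, hv⟩
  obtain ⟨d, -, h1, h2⟩ := w.exists_boundary_dart (Subtype.val ⁻¹' A) huA hvA
  exact ⟨_, d.fst.2, _, d.snd.2, h1, h2, d.adj⟩

/-- The centre of the star of non-literal vertices containing a given vertex; a literal vertex is
its own centre. -/
def root : SatVert n m q → SatVert n m q
  | .inr (.inr (.inl (i, k, _))) => helper i k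
  | .inr (.inr (.inr (.inr (.inl (j, _))))) => clause j
  | .inr (.inr (.inr (.inr (.inr (.inr (i, _)))))) => bridge i
  | v => v

lemma Edge.root_src_eq_or_tgt_eq_lit (e : Edge n m q C) :
    root e.src = root e.tgt ∨ ∃ l, e.tgt = lit l := by
  rcases e with ⟨i, k, b⟩ | ⟨i, k, k'⟩ | ⟨j, l, hl⟩ | ⟨j, p⟩ | ⟨i, s, b⟩ | ⟨i, k⟩ <;>
    simp [Edge.src, Edge.tgt, root]

section Connected

variable {S : Set (SatVert n m q)}

lemma root_eq_of_forall_lit_notMem (hS : ((satGadget n m q C).induce S).Connected)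
    (hlit : ∀ l, lit l ∉ S) {u v : SatVert n m q} (hu : u ∈ S) (hv : v ∈ S) :
    root v = root u := by
  by_contra hne
  obtain ⟨x, hx, y, hy, hxA, hyA, h⟩ :=
    exists_adj_of_mem_of_notMem hS {x | root x = root u} hu hv rfl hne
  obtain ⟨e, ⟨rfl, rfl⟩ | ⟨rfl, rfl⟩⟩ := adj_iff.1 h <;>
    obtain h | ⟨l, hl⟩ := e.root_src_eq_or_tgt_eq_lit
  · exact hyA (h.symm.trans hxA)
  · exact hlit l (hl ▸ hy)
  · exact hyA (h.trans hxA)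
  · exact hlit l (hl ▸ hx)

lemma helper_mem_of_pendant (hS : ((satGadget n m q C).induce S).Connected) {l₀ : Fin n × Bool}
    (hl₀ : lit l₀ ∈ S) {i k k'} (h : helperPendant i k k' ∈ S) : helper i k ∈ S := by
  obtain ⟨x, hx, y, hy, rfl, -, h⟩ :=
    exists_adj_of_mem_of_notMem hS {helperPendant i k k'} h hl₀ rfl (by simp)
  obtain ⟨e, ⟨h1, rfl⟩ | ⟨rfl, h1⟩⟩ := adj_iff.1 h <;>
  rcases e with ⟨i, k, b⟩ | ⟨i, k, k'⟩ | ⟨j, l, hl⟩ | ⟨j, p⟩ | ⟨i, s, b⟩ | ⟨i, k⟩ <;>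
    simp_all [Edge.src, Edge.tgt]

lemma clause_mem_of_pendant (hS : ((satGadget n m q C).induce S).Connected) {l₀ : Fin n × Bool}
    (hl₀ : lit l₀ ∈ S) {j p} (h : clausePendant j p ∈ S) : clause j ∈ S := by
  obtain ⟨x, hx, y, hy, rfl, -, h⟩ :=
    exists_adj_of_mem_of_notMem hS {clausePendant j p} h hl₀ rfl (by simp)
  obtain ⟨e, ⟨h1, rfl⟩ | ⟨rfl, h1⟩⟩ := adj_iff.1 h <;>
  rcases e with ⟨i, k, b⟩ | ⟨i, k, k'⟩ | ⟨j, l, hl⟩ | ⟨j, p⟩ | ⟨i, s, b⟩ | ⟨i, k⟩ <;>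
    simp_all [Edge.src, Edge.tgt]

lemma exists_lit_of_helper_mem (hS : ((satGadget n m q C).induce S).Connected) {l₀ : Fin n × Bool}
    (hl₀ : lit l₀ ∈ S) {i k} (h : helper i k ∈ S) : ∃ b, lit (i, b) ∈ S := by
  obtain ⟨x, hx, y, hy, hxA, hyA, h⟩ := exists_adj_of_mem_of_notMem hS
    {x | root x = helper i k} h hl₀ rfl (by simp [root])
  obtain ⟨e, ⟨rfl, rfl⟩ | ⟨rfl, rfl⟩⟩ := adj_iff.1 h <;>
  rcases e with ⟨i, k, b⟩ | ⟨i, k, k'⟩ | ⟨j, l, hl⟩ | ⟨j, p⟩ | ⟨i, s, b⟩ | ⟨i, k⟩ <;>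
    simp [Edge.src, Edge.tgt, root] at hx hy hxA hyA <;> grind

lemma exists_lit_of_clause_mem (hS : ((satGadget n m q C).induce S).Connected) {l₀ : Fin n × Bool}
    (hl₀ : lit l₀ ∈ S) {j} (h : clause j ∈ S) : ∃ l ∈ C j, lit l ∈ S := by
  obtain ⟨x, hx, y, hy, hxA, hyA, h⟩ := exists_adj_of_mem_of_notMem hS
    {x | root x = clause j} h hl₀ rfl (by simp [root])
  obtain ⟨e, ⟨rfl, rfl⟩ | ⟨rfl, rfl⟩⟩ := adj_iff.1 h <;>
  rcases e with ⟨i, k, b⟩ | ⟨i, k, k'⟩ | ⟨j, l, hl⟩ | ⟨j, p⟩ | ⟨i, s, b⟩ | ⟨i, k⟩ <;>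
    simp [Edge.src, Edge.tgt, root] at hx hy hxA hyA <;> grind

lemma cross_of_iff {u v : SatVert n m q} (h : u ∈ S ↔ v ∈ S) : cross S u v = 0 := by
  simp [cross, h]

lemma sum_cross_le {ι : Type*} [Fintype ι] (S : Set (SatVert n m q))
    (f g : ι → SatVert n m q) : ∑ x, cross S (f x) (g x) ≤ Fintype.card ι :=
  (Finset.sum_le_card_nsmul _ _ 1 fun _ _ => cross_le_one S _ _).trans (by simp)

open Classical in
/-- A variable with both or neither of its literal vertices in `S` loses at least `q ^ 2` edges. -/
lemma sum_helper_add_le (hS : ((satGadget n m q C).induce S).Connected) {l₀ : Fin n × Bool}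
    (hl₀ : lit l₀ ∈ S) (hq : 2 ≤ q ^ 2) (i : Fin n) :
    ∑ k, (∑ b, cross S (helper i k) (lit (i, b)) +
        ∑ k', cross S (helperPendant i k k') (helper i k)) +
      (if lit (i, true) ∈ S ↔ lit (i, false) ∈ S then q ^ 2 else 0) ≤ q ^ 2 * (q ^ 2 + 1) := by
  have hk (k : Fin (q ^ 2)) : ∑ b, cross S (helper i k) (lit (i, b)) +
      ∑ k', cross S (helperPendant i k k') (helper i k) +
      (if lit (i, true) ∈ S ↔ lit (i, false) ∈ S then 1 else 0) ≤ q ^ 2 + 1 := by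
    by_cases h : helper i k ∈ S
    · have h1 := sum_cross_le S (fun k' => helperPendant i k k') (fun _ => helper i k)
      rw [Fintype.card_fin] at h1
      obtain ⟨b, hb⟩ := exists_lit_of_helper_mem hS hl₀ h
      rw [Fintype.sum_bool]
      by_cases ht : lit (i, true) ∈ S <;> by_cases hf : lit (i, false) ∈ S
      · simp only [cross, h, ht, hf] at h1 ⊢; simpa using h1
      · simp only [cross, h, ht, hf] at h1 ⊢; simp at h1 ⊢; omega
      · simp only [cross, h, ht, hf] at h1 ⊢; simp at h1 ⊢; omega
      · cases b <;> contradiction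
    · have h1 : ∑ k', cross S (helperPendant i k k') (helper i k) = 0 :=
        Finset.sum_eq_zero fun k' _ => cross_of_iff
          ⟨fun h' => helper_mem_of_pendant hS hl₀ h', fun h' => absurd h' h⟩
      have h2 := sum_cross_le S (fun _ => helper i k) (fun b => lit (i, b))
      rw [Fintype.card_bool] at h2
      split_ifs <;> omega
  have := Finset.sum_le_card_nsmul Finset.univ _ _ fun k _ => hk k
  rw [Finset.sum_add_distrib] at this
  refine le_trans (le_of_eq ?_) (this.trans (by simp))
  congr 1
  split_ifs <;> simp

open Classical in
/-- A clause vertex outside `S` loses `q` edges. -/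
lemma sum_clause_add_le (hS : ((satGadget n m q C).induce S).Connected) {l₀ : Fin n × Bool}
    (hl₀ : lit l₀ ∈ S) {j : Fin m} (hC : (C j).card = 3) :
    ∑ l : C j, cross S (clause j) (lit l) + ∑ p, cross S (clausePendant j p) (clause j) +
      (if clause j ∈ S then 0 else q) ≤ q + 3 := by
  have h1 := sum_cross_le S (fun _ => clause j) (fun l : C j => lit l)
  rw [Fintype.card_coe, hC] at h1
  split_ifs with h
  · have h2 := sum_cross_le S (fun p => clausePendant j p) (fun _ => clause j)
    rw [Fintype.card_fin] at h2
    omega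
  · have h2 : ∑ p, cross S (clausePendant j p) (clause j) = 0 :=
      Finset.sum_eq_zero fun p _ => cross_of_iff
        ⟨fun h' => clause_mem_of_pendant hS hl₀ h', fun h' => absurd h' h⟩
    omega

lemma sum_clause_le (S : Set (SatVert n m q)) {j : Fin m} (hC : (C j).card = 3) :
    ∑ l : C j, cross S (clause j) (lit l) + ∑ p, cross S (clausePendant j p) (clause j) ≤
      q + 3 := by
  have h1 := sum_cross_le S (fun _ => clause j) (fun l : C j => lit l)
  have h2 := sum_cross_le S (fun p => clausePendant j p) (fun _ => clause j)
  rw [Fintype.card_coe, hC] at h1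
  rw [Fintype.card_fin] at h2
  omega

lemma sum_bridge_le (S : Set (SatVert n m q)) (i : Fin (n - 1)) :
    ∑ s, ∑ b, cross S (bridge i) (lit (bridgeVar i s, b)) +
      ∑ k, cross S (bridgePendant i k) (bridge i) ≤ q ^ 2 + 4 := by
  have h1 (s : Bool) := sum_cross_le S (fun _ => bridge i) (fun b => lit (bridgeVar i s, b))
  have h2 := sum_cross_le S (fun k => bridgePendant i k) (fun _ => bridge i)
  simp only [Fintype.card_bool] at h1
  have := h1 true
  have := h1 false
  rw [Fintype.card_fin] at h2
  rw [Fintype.sum_bool]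
  omega

lemma sum_bridge_le_of_not_iff (hxor : ∀ i, ¬ (lit (i, true) ∈ S ↔ lit (i, false) ∈ S))
    (i : Fin (n - 1)) :
    ∑ s, ∑ b, cross S (bridge i) (lit (bridgeVar i s, b)) +
      ∑ k, cross S (bridgePendant i k) (bridge i) ≤ q ^ 2 + 2 := by
  have h1 (s : Bool) : ∑ b, cross S (bridge i) (lit (bridgeVar i s, b)) = 1 := by
    have := hxor (bridgeVar i s)
    rw [Fintype.sum_bool]
    by_cases h : bridge i ∈ S <;> by_cases ht : lit (bridgeVar i s, true) ∈ S <;>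
      by_cases hf : lit (bridgeVar i s, false) ∈ S <;> simp_all [cross]
  have h2 := sum_cross_le S (fun k => bridgePendant i k) (fun _ => bridge i)
  rw [Fintype.card_fin] at h2
  simp only [h1, Fintype.sum_bool]
  omega

/-- Without literal vertices, a connected `S` meets the star of at most one helper vertex. -/
lemma sum_helper_le_of_forall_lit_notMem (hS : ((satGadget n m q C).induce S).Connected)
    (hne : S.Nonempty) (hlit : ∀ l, lit l ∉ S) :
    ∑ i, ∑ k, (∑ b, cross S (helper i k) (lit (i, b)) +
      ∑ k', cross S (helperPendant i k k') (helper i k)) ≤ q ^ 2 + 2 := by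
  classical
  obtain ⟨u, hu⟩ := hne
  have hle (i k) : ∑ b, cross S (helper i k) (lit (i, b)) +
      ∑ k', cross S (helperPendant i k k') (helper i k) ≤ q ^ 2 + 2 := by
    have h1 := sum_cross_le S (fun _ => helper i k) (fun b => lit (i, b))
    have h2 := sum_cross_le S (fun k' => helperPendant i k k') (fun _ => helper i k)
    rw [Fintype.card_bool] at h1
    rw [Fintype.card_fin] at h2
    omega
  have hzero (i k) (h : helper i k ≠ root u) : ∑ b, cross S (helper i k) (lit (i, b)) +
      ∑ k', cross S (helperPendant i k k') (helper i k) = 0 := by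
    have hout (v) (hv : root v = helper i k) : v ∉ S := fun hvS =>
      h (hv.symm.trans (root_eq_of_forall_lit_notMem hS hlit hu hvS))
    have h1 : helper i k ∉ S := hout _ rfl
    have h2 (k') : helperPendant i k k' ∉ S := hout _ rfl
    simp only [cross, h1, h2, hlit, iff_self, if_true, Finset.sum_const_zero, add_zero]
  rw [← Fintype.sum_prod_type']
  by_cases hr : ∃ p : Fin n × Fin (q ^ 2), helper p.1 p.2 = root u
  · obtain ⟨p, hp⟩ := hr
    rw [Finset.sum_eq_single p]
    · exact hle _ _
    · intro p' _ hne
      refine hzero _ _ fun h => hne ?_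
      simpa using h.trans hp.symm
    · simp
  · push Not at hr
    rw [Finset.sum_eq_zero fun p _ => hzero _ _ (hr p)]
    exact Nat.zero_le _

/-- A large connected cut yields a satisfying assignment: the variables whose positive literal vertex
lies in `S` are set to true. -/
lemma exists_assignment_of_le_ncard (hn : 1 ≤ n) (hC : ∀ j, (C j).card = 3)
    (hq : 3 * m + 2 * n + 2 ≤ q) (hne : S.Nonempty)
    (hS : ((satGadget n m q C).induce S).Connected)
    (hcut : m * q + n * q ^ 4 + (2 * n - 1) * q ^ 2 + 2 * (n - 1) ≤
      (cutEdges (satGadget n m q C) S).ncard) :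
    ∃ α : Fin n → Bool, ∀ j, ∃ l ∈ C j, α l.1 = l.2 := by
  classical
  rw [ncard_cutEdges] at hcut
  have hqK : q ≤ q ^ 2 := Nat.le_self_pow two_ne_zero q
  have hclause := Finset.sum_le_card_nsmul Finset.univ _ _
    fun j _ => sum_clause_le (C := C) S (hC j)
  have hbridge := Finset.sum_le_card_nsmul Finset.univ _ _ fun i _ => sum_bridge_le S i
  simp only [Finset.card_univ, Fintype.card_fin, smul_eq_mul] at hclause hbridge
  have hpow : q ^ 4 = q ^ 2 * q ^ 2 := by ring
  obtain ⟨a, rfl⟩ : ∃ a, n = a + 1 := ⟨n - 1, by omega⟩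
  have h2n : 2 * (a + 1) - 1 = 2 * a + 1 := by omega
  rw [hpow, h2n] at hcut
  by_cases hlit : ∀ l, lit l ∉ S
  · exfalso
    have hhelper := sum_helper_le_of_forall_lit_notMem hS hne hlit
    have hexp : (a + 1) * (q ^ 2 * q ^ 2) = a * (q ^ 2 * q ^ 2) + q ^ 2 * q ^ 2 := by ring
    have : q ^ 2 ≤ q ^ 2 * q ^ 2 := Nat.le_mul_self _
    simp only [Nat.add_sub_cancel] at hcut hbridge
    nlinarith
  push Not at hlit
  obtain ⟨l₀, hl₀⟩ := hlit
  have hhelper := Finset.sum_le_card_nsmul Finset.univ _ _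
    fun i _ => sum_helper_add_le hS hl₀ (by omega) i
  rw [Finset.sum_add_distrib] at hhelper
  simp only [Finset.card_univ, Fintype.card_fin, smul_eq_mul] at hhelper
  have hxor : ∀ i, ¬ (lit (i, true) ∈ S ↔ lit (i, false) ∈ S) := by
    intro i hi
    have h := Finset.single_le_sum (f := fun i : Fin (a + 1) =>
      if lit (i, true) ∈ S ↔ lit (i, false) ∈ S then q ^ 2 else 0)
      (fun _ _ => Nat.zero_le _) (Finset.mem_univ i)
    simp only [hi, iff_self, if_true] at h
    simp only [Nat.add_sub_cancel] at hcut hbridge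
    nlinarith
  have hbridge' := Finset.sum_le_card_nsmul Finset.univ _ _
    fun i _ => sum_bridge_le_of_not_iff hxor i
  have hclause' := Finset.sum_le_card_nsmul Finset.univ _ _
    fun j _ => sum_clause_add_le hS hl₀ (hC j)
  rw [Finset.sum_add_distrib] at hclause'
  simp only [Finset.card_univ, Fintype.card_fin, smul_eq_mul] at hbridge' hclause'
  have hhelper' := (Nat.le_add_right _ _).trans hhelper
  have hmem : ∀ j : Fin m, clause j ∈ S := by
    intro j
    by_contra hj
    have h := Finset.single_le_sum (f := fun j : Fin m => if clause j ∈ S then 0 else q)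
      (fun _ _ => Nat.zero_le _) (Finset.mem_univ j)
    simp only [hj, if_false] at h
    simp only [Nat.add_sub_cancel] at hcut hbridge'
    nlinarith
  refine ⟨fun i => decide (lit (i, true) ∈ S), fun j => ?_⟩
  obtain ⟨⟨i, b⟩, hl, hlS⟩ := exists_lit_of_clause_mem hS hl₀ (hmem j)
  refine ⟨_, hl, ?_⟩
  cases b
  · simpa using fun h => hxor i (by simp [h, hlS])
  · simpa using hlS

end Connected

/-- The side of the cut encoding an assignment: the true literals and the centres of all stars. -/
def assignmentSide (α : Fin n → Bool) : Set (SatVert n m q) :=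
  {x | match x with
    | .inl l => α l.1 = l.2
    | x => root x = x}

lemma assignmentSide_connected (hn : 1 ≤ n) {α : Fin n → Bool}
    (hα : ∀ j, ∃ l ∈ C j, α l.1 = l.2) :
    ((satGadget n m q C).induce (assignmentSide α)).Connected := by
  have hlit (i : Fin n) : (lit (i, α i) : SatVert n m q) ∈ assignmentSide α := rfl
  have hreach (e : Edge n m q C) (h1 : e.src ∈ assignmentSide α) (h2 : e.tgt ∈ assignmentSide α) :
      ((satGadget n m q C).induce (assignmentSide α)).Reachable ⟨_, h2⟩ ⟨_, h1⟩ :=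
    SimpleGraph.Adj.reachable (adj_iff.2 ⟨e, .inr ⟨rfl, rfl⟩⟩)
  rw [SimpleGraph.connected_iff_exists_forall_reachable]
  have hall (k : ℕ) : ∀ hk : k < n, ((satGadget n m q C).induce (assignmentSide α)).Reachable
      ⟨lit (⟨0, hn⟩, α ⟨0, hn⟩), hlit _⟩ ⟨lit (⟨k, hk⟩, α ⟨k, hk⟩), hlit _⟩ := by
    induction k with
    | zero => intro _; rfl
    | succ k ih =>
      intro hk
      refine (ih (by omega)).trans ?_
      let i : Fin (n - 1) := ⟨k, by omega⟩
      exact (hreach (.inr (.inr (.inr (.inr (.inl (i, false, α ⟨k, by omega⟩)))))) rfl rfl).trans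
        (hreach (.inr (.inr (.inr (.inr (.inl (i, true, α ⟨k + 1, hk⟩)))))) rfl rfl).symm
  refine ⟨⟨lit (⟨0, hn⟩, α ⟨0, hn⟩), hlit _⟩, ?_⟩
  rintro ⟨⟨i, b⟩ | ⟨i, k⟩ | ⟨i, k, k'⟩ | j | ⟨j, p⟩ | i | ⟨i, k⟩, hx⟩
  · obtain rfl : α i = b := hx
    exact hall i i.2
  · exact (hall i i.2).trans (hreach (.inl (i, k, α i)) rfl rfl)
  · simp [assignmentSide, root] at hx
  · obtain ⟨⟨i, b⟩, hl, h⟩ := hα j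
    obtain rfl : α i = b := h
    exact (hall i i.2).trans (hreach (.inr (.inr (.inl ⟨j, _, hl⟩))) rfl rfl)
  · simp [assignmentSide, root] at hx
  · have hi : (i : ℕ) < n := by omega
    exact (hall i hi).trans
      (hreach (.inr (.inr (.inr (.inr (.inl (i, false, α ⟨i, hi⟩)))))) rfl rfl)
  · simp [assignmentSide, root] at hx

lemma le_ncard_cutEdges_assignmentSide (hn : 1 ≤ n) (α : Fin n → Bool) :
    m * q + n * q ^ 4 + (2 * n - 1) * q ^ 2 + 2 * (n - 1) ≤
      (cutEdges (satGadget n m q C) (assignmentSide α)).ncard := by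
  have hlit (l) : (lit l : SatVert n m q) ∈ assignmentSide α ↔ α l.1 = l.2 := Iff.rfl
  have h1 (i k) : (helper i k : SatVert n m q) ∈ assignmentSide α := rfl
  have h2 (j) : (clause j : SatVert n m q) ∈ assignmentSide α := rfl
  have h3 (i) : (bridge i : SatVert n m q) ∈ assignmentSide α := rfl
  have h4 (i k k') : (helperPendant i k k' : SatVert n m q) ∉ assignmentSide α := by
    simp [assignmentSide, root]
  have h5 (j p) : (clausePendant j p : SatVert n m q) ∉ assignmentSide α := by
    simp [assignmentSide, root]
  have h6 (i k) : (bridgePendant i k : SatVert n m q) ∉ assignmentSide α := by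
    simp [assignmentSide, root]
  have hb (u : SatVert n m q) (hu : u ∈ assignmentSide α) (i : Fin n) :
      ∑ b, cross (assignmentSide α) u (lit (i, b)) = 1 := by
    cases h : α i <;> simp only [Fintype.sum_bool, cross, hu, hlit, h] <;> simp
  have hp (u v : SatVert n m q) (hu : u ∉ assignmentSide α) (hv : v ∈ assignmentSide α) :
      cross (assignmentSide α) u v = 1 := by
    simp [cross, hu, hv]
  rw [ncard_cutEdges]
  simp only [hb _ (h1 _ _), hb _ (h3 _), hp _ _ (h4 _ _ _) (h1 _ _), hp _ _ (h5 _ _) (h2 _),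
    hp _ _ (h6 _ _) (h3 _), Finset.sum_add_distrib, Finset.sum_const, Finset.card_univ,
    Fintype.card_fin, Fintype.card_bool, smul_eq_mul]
  obtain ⟨a, rfl⟩ : ∃ a, n = a + 1 := ⟨n - 1, by omega⟩
  have h2n : 2 * (a + 1) - 1 = 2 * a + 1 := by omega
  rw [h2n, Nat.add_sub_cancel]
  generalize ∑ j, ∑ l : C j, cross (assignmentSide α) (clause (q := q) j) (lit l) = t
  linarith

end SatGadget

theorem stmt6 (n m : ℕ) (hn : 1 ≤ n) (hm : 1 ≤ m) :
    ∃ K₀ : ℕ, 0 < K₀ ∧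
      ∀ C : Fin m → Finset (Fin n × Bool),
        (∀ j, (C j).card = 3 ∧ ((C j).image Prod.fst).card = 3) →
        ∀ q : ℕ, K₀ ≤ q →
          ((∃ α : Fin n → Bool, ∀ j, ∃ l ∈ C j, α l.1 = l.2) ↔
            ∃ S : Set (SatVert n m q), S.Nonempty ∧
              ((satGadget n m q C).induce S).Connected ∧
              m * q + n * q ^ 4 + (2 * n - 1) * q ^ 2 + 2 * (n - 1) ≤
                (cutEdges (satGadget n m q C) S).ncard) := by
  refine ⟨3 * m + 2 * n + 2, by omega, fun C hC q hq => ⟨?_, ?_⟩⟩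
  · rintro ⟨α, hα⟩
    exact ⟨SatGadget.assignmentSide α, ⟨SatGadget.lit (⟨0, hn⟩, α ⟨0, hn⟩), rfl⟩,
      SatGadget.assignmentSide_connected hn hα,
      SatGadget.le_ncard_cutEdges_assignmentSide hn α⟩
  · rintro ⟨S, hne, hS, hcut⟩
    exact SatGadget.exists_assignment_of_le_ncard hn (fun j => (hC j).1) hq hne hS hcut
end
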